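/- Sperner's lemma (strong form): let S be a simplicial subdivision of the d-dimensional standard simplex Δ^d = conv(e₁,…,e_{d+1}) ⊂ ℝ^{d+1}, and let λ be a Sperner labeling of the vertices of S. Then the number of fully-labeled d-simplices of S (those whose vertices carry all d+1 labels) is odd. -/

import Mathlib

open scoped Classical

/-- A simplicial subdivision of the standard `d`-simplex
`Δ^d = conv(e₁,…,e_{d+1}) ⊂ ℝ^{d+1}`: a finite collection of simplices (given by
their vertex sets, which are affinely independent), closed under taking nonempty
subfaces, such that any two simplices intersect in the convex hull of a common
face and the union of the simplices is `Δ^d`. -/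
structure SimplicialSubdivision (d : ℕ) where
  simplices : Finset (Finset (Fin (d + 1) → ℝ))
  nonempty_mem : ∀ σ ∈ simplices, σ.Nonempty
  indep : ∀ σ ∈ simplices,
    AffineIndependent ℝ (fun v : (σ : Set (Fin (d + 1) → ℝ)) => (v : Fin (d + 1) → ℝ))
  down_closed : ∀ σ ∈ simplices, ∀ τ, τ ⊆ σ → τ.Nonempty → τ ∈ simplices
  inter_face : ∀ σ ∈ simplices, ∀ τ ∈ simplices,
    convexHull ℝ (σ : Set (Fin (d + 1) → ℝ)) ∩ convexHull ℝ (τ : Set (Fin (d + 1) → ℝ)) =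
      convexHull ℝ ((σ ∩ τ : Finset (Fin (d + 1) → ℝ)) : Set (Fin (d + 1) → ℝ))
  covers : (⋃ σ ∈ simplices, convexHull ℝ (σ : Set (Fin (d + 1) → ℝ)))
      = stdSimplex ℝ (Fin (d + 1))


namespace SpernerAux

variable {d : ℕ}

/-- Membership in the cone spanned by a finite set of vectors. -/
def InCone (σ : Finset (Fin (d + 1) → ℝ)) (x : Fin (d + 1) → ℝ) : Prop :=
  ∃ a : (Fin (d + 1) → ℝ) → ℝ, (∀ v ∈ σ, 0 ≤ a v) ∧ ∑ v ∈ σ, a v • v = x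

/-- The coordinate subspace of the vectors supported on the first `k` coordinates. -/
def coordSub (d k : ℕ) : Submodule ℝ (Fin (d + 1) → ℝ) where
  carrier := {x | ∀ i : Fin (d + 1), k ≤ i.val → x i = 0}
  add_mem' := by
    intro a b ha hb i hi
    simp [ha i hi, hb i hi]
  zero_mem' := by
    intro i _
    rfl
  smul_mem' := by
    intro c x hx i hi
    simp [hx i hi]

lemma mem_coordSub {k : ℕ} {x : Fin (d + 1) → ℝ} :
    x ∈ coordSub d k ↔ ∀ i : Fin (d + 1), k ≤ i.val → x i = 0 := Iff.rfl

lemma finrank_coordSub {k : ℕ} (hk : k ≤ d + 1) : Module.finrank ℝ (coordSub d k) = k := by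
  let f : coordSub d k →ₗ[ℝ] (Fin k → ℝ) :=
    (LinearMap.funLeft ℝ ℝ (Fin.castLE hk)).comp (coordSub d k).subtype
  have hf : ∀ x i, f x i = x.1 (Fin.castLE hk i) := fun x i => rfl
  have hb : Function.Bijective f := by
    constructor
    · intro x y hxy
      apply Subtype.ext
      funext i
      by_cases hi : i.val < k
      · have := congrFun hxy ⟨i.val, hi⟩
        simpa [hf] using this
      · rw [x.2 i (by omega), y.2 i (by omega)]
    · intro y
      refine ⟨⟨fun i => if h : i.val < k then y ⟨i.val, h⟩ else 0, ?_⟩, ?_⟩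
      · intro i hi
        simp [hi]
      · funext i
        simp [hf]
  rw [(LinearEquiv.ofBijective f hb).finrank_eq]
  simp

lemma vertex_mem (S : SimplicialSubdivision d) {σ : Finset (Fin (d + 1) → ℝ)}
    (hσ : σ ∈ S.simplices) {v : Fin (d + 1) → ℝ} (hv : v ∈ σ) :
    (∀ i, 0 ≤ v i) ∧ ∑ i, v i = 1 := by
  have : v ∈ stdSimplex ℝ (Fin (d + 1)) := by
    rw [← S.covers]
    simp only [Set.mem_iUnion]
    exact ⟨σ, hσ, subset_convexHull ℝ _ hv⟩
  exact this

lemma sum_coord (σ : Finset (Fin (d + 1) → ℝ)) (h : ∀ v ∈ σ, ∑ i, v i = 1)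
    (a : (Fin (d + 1) → ℝ) → ℝ) :
    ∑ i, (∑ v ∈ σ, a v • v) i = ∑ v ∈ σ, a v := by
  simp only [Finset.sum_apply, Pi.smul_apply, smul_eq_mul]
  rw [Finset.sum_comm]
  refine Finset.sum_congr rfl fun v hv => ?_
  rw [← Finset.mul_sum, h v hv, mul_one]

lemma lin_indep (S : SimplicialSubdivision d) {σ : Finset (Fin (d + 1) → ℝ)}
    (hσ : σ ∈ S.simplices) (f : (Fin (d + 1) → ℝ) → ℝ)
    (h : ∑ v ∈ σ, f v • v = 0) : ∀ v ∈ σ, f v = 0 := by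
  have hs : ∑ v ∈ σ, f v = 0 := by
    rw [← sum_coord σ (fun v hv => (vertex_mem S hσ hv).2), h]
    simp
  have := affineIndependent_iff.1 (S.indep σ hσ) Finset.univ (fun v => f v.1)
    (by
      rw [← hs]
      exact Finset.sum_coe_sort σ f)
    (by
      rw [← h]
      exact Finset.sum_coe_sort σ (fun v => f v • v))
  intro v hv
  exact this ⟨v, hv⟩ (Finset.mem_univ _)

lemma mem_hull_iff {σ : Finset (Fin (d + 1) → ℝ)}
    (h : ∀ v ∈ σ, ∑ i, v i = 1) {x : Fin (d + 1) → ℝ} :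
    x ∈ convexHull ℝ (σ : Set (Fin (d + 1) → ℝ)) ↔ InCone σ x ∧ ∑ i, x i = 1 := by
  rw [Finset.mem_convexHull']
  constructor
  · rintro ⟨w, h0, h1, rfl⟩
    exact ⟨⟨w, h0, rfl⟩, by rw [sum_coord σ h, h1]⟩
  · rintro ⟨⟨w, h0, rfl⟩, h1⟩
    exact ⟨w, h0, by rw [← h1, sum_coord σ h], rfl⟩

lemma InCone.smul {σ : Finset (Fin (d + 1) → ℝ)} {x : Fin (d + 1) → ℝ} (h : InCone σ x)
    {c : ℝ} (hc : 0 ≤ c) : InCone σ (c • x) := by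
  obtain ⟨a, ha, rfl⟩ := h
  refine ⟨fun v => c * a v, fun v hv => mul_nonneg hc (ha v hv), ?_⟩
  rw [Finset.smul_sum]
  simp [mul_smul]

lemma cone_inter (S : SimplicialSubdivision d) {σ τ : Finset (Fin (d + 1) → ℝ)}
    (hσ : σ ∈ S.simplices) (hτ : τ ∈ S.simplices) {x : Fin (d + 1) → ℝ}
    (h1 : InCone σ x) (h2 : InCone τ x) (hx : 0 < ∑ i, x i) : InCone (σ ∩ τ) x := by
  set s := ∑ i, x i with hs
  have hsum : ∑ i, (s⁻¹ • x) i = 1 := by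
    simp only [Pi.smul_apply, smul_eq_mul]
    rw [← Finset.mul_sum, ← hs, inv_mul_cancel₀ hx.ne']
  have hinv : 0 ≤ s⁻¹ := (inv_pos.2 hx).le
  have e1 := (mem_hull_iff (fun v hv => (vertex_mem S hσ hv).2)).2 ⟨h1.smul hinv, hsum⟩
  have e2 := (mem_hull_iff (fun v hv => (vertex_mem S hτ hv).2)).2 ⟨h2.smul hinv, hsum⟩
  have e3 : s⁻¹ • x ∈ convexHull ℝ ((σ ∩ τ : Finset (Fin (d + 1) → ℝ)) : Set (Fin (d + 1) → ℝ)) := by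
    rw [← S.inter_face σ hσ τ hτ]
    exact ⟨e1, e2⟩
  have e4 := ((mem_hull_iff (fun v hv =>
    (vertex_mem S hσ (Finset.mem_inter.1 hv).1).2)).1 e3).1.smul hx.le
  rwa [smul_inv_smul₀ hx.ne'] at e4

/-- A functional vanishing on `τ` and not on the coordinate subspace has kernel the span of `τ`. -/
lemma ker_span (S : SimplicialSubdivision d) {τ : Finset (Fin (d + 1) → ℝ)}
    (hτ : τ ∈ S.simplices) (hcard : τ.card + 1 ≤ d + 1)
    (hV : ∀ v ∈ τ, v ∈ coordSub d (τ.card + 1))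
    (l : (Fin (d + 1) → ℝ) →ₗ[ℝ] ℝ) (hl : ∀ v ∈ τ, l v = 0)
    {u : Fin (d + 1) → ℝ} (hu : u ∈ coordSub d (τ.card + 1)) (hlu : l u ≠ 0)
    {x : Fin (d + 1) → ℝ} (hx : x ∈ coordSub d (τ.card + 1)) (hlx : l x = 0) :
    ∃ a : (Fin (d + 1) → ℝ) → ℝ, ∑ v ∈ τ, a v • v = x := by
  have hli : LinearIndepOn ℝ id (τ : Set (Fin (d + 1) → ℝ)) :=
    linearIndepOn_finset_iff.2 (fun f hf => lin_indep S hτ f hf)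
  have h1 := finrank_span_finset_eq_card hli
  have h2 : Submodule.span ℝ (τ : Set (Fin (d + 1) → ℝ)) ≤ coordSub d (τ.card + 1) ⊓ LinearMap.ker l := by
    rw [Submodule.span_le]
    intro v hv
    exact ⟨hV v hv, hl v hv⟩
  have h3 : coordSub d (τ.card + 1) ⊓ LinearMap.ker l < coordSub d (τ.card + 1) := by
    refine lt_of_le_of_ne inf_le_left fun h => hlu ?_
    rw [← h] at hu
    exact hu.2
  have h4 := Submodule.finrank_lt_finrank_of_lt h3
  rw [finrank_coordSub hcard] at h4
  have h5 := Submodule.eq_of_le_of_finrank_le h2 (by rw [h1]; omega)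
  have h6 : x ∈ Submodule.span ℝ (τ : Set (Fin (d + 1) → ℝ)) := by
    rw [h5]
    exact ⟨hx, hlx⟩
  obtain ⟨f, -, hf⟩ := Submodule.mem_span_finset.1 h6
  exact ⟨f, hf⟩

lemma exists_functional {τ : Finset (Fin (d + 1) → ℝ)}
    (hcard : τ.card + 1 ≤ d + 1) :
    ∃ l : (Fin (d + 1) → ℝ) →ₗ[ℝ] ℝ, (∀ v ∈ τ, l v = 0) ∧
      ∃ u ∈ coordSub d (τ.card + 1), l u ≠ 0 := by
  have : ¬ coordSub d (τ.card + 1) ≤ Submodule.span ℝ (τ : Set (Fin (d + 1) → ℝ)) := by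
    intro h
    have h1 := Submodule.finrank_mono h
    have h2 := finrank_span_finset_le_card (R := ℝ) τ
    rw [finrank_coordSub hcard] at h1
    unfold Set.finrank at h2
    omega
  obtain ⟨u, hu, hu'⟩ := SetLike.not_le_iff_exists.1 this
  obtain ⟨l, h1, h2⟩ := Submodule.exists_le_ker_of_notMem hu'
  exact ⟨l, fun v hv => h2 (Submodule.subset_span hv), u, hu, h1⟩

lemma side_unique (S : SimplicialSubdivision d) {τ : Finset (Fin (d + 1) → ℝ)}
    (hτ : τ ∈ S.simplices) (hcard : τ.card + 1 ≤ d + 1)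
    (hV : ∀ v ∈ τ, v ∈ coordSub d (τ.card + 1))
    (l : (Fin (d + 1) → ℝ) →ₗ[ℝ] ℝ) (hl : ∀ v ∈ τ, l v = 0)
    {w w' : Fin (d + 1) → ℝ} (hw : w ∈ coordSub d (τ.card + 1))
    (hw' : w' ∈ coordSub d (τ.card + 1))
    (hws : insert w τ ∈ S.simplices) (hws' : insert w' τ ∈ S.simplices)
    (hpos : 0 < l w * l w') : w = w' := by
  by_contra hne
  have hlw : l w ≠ 0 := fun h => by simp [h] at hpos
  have hlw' : l w' ≠ 0 := fun h => by simp [h] at hpos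
  have hwτ : w ∉ τ := fun h => hlw (hl w h)
  have hwτ' : w' ∉ τ := fun h => hlw' (hl w' h)
  set c := l w / l w' with hc
  have hcpos : 0 < c := by
    rw [hc, div_eq_mul_inv]
    have : l w * (l w')⁻¹ = l w * l w' * ((l w')⁻¹ * (l w')⁻¹) := by field_simp
    rw [this]
    exact mul_pos hpos (mul_self_pos.2 (inv_ne_zero hlw'))
  obtain ⟨a, ha⟩ := ker_span S hτ hcard hV l hl hw hlw (x := w - c • w')
    (Submodule.sub_mem _ hw (Submodule.smul_mem _ _ hw'))
    (by simp [hc, hlw'])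
  set M := 1 + ∑ v ∈ τ, |a v| with hM
  have hMpos : 0 < M := by
    have : 0 ≤ ∑ v ∈ τ, |a v| := Finset.sum_nonneg fun v _ => abs_nonneg _
    linarith
  have hMa : ∀ v ∈ τ, 0 ≤ M + a v := by
    intro v hv
    have h1 := Finset.single_le_sum (f := fun v => |a v|) (fun v _ => abs_nonneg _) hv
    have h2 := neg_abs_le (a v)
    linarith
  -- the test point, in the interior of both simplices
  set p : Fin (d + 1) → ℝ := ∑ v ∈ τ, M • v + w with hp
  have hp1 : InCone (insert w τ) p := by
    refine ⟨fun v => if v = w then 1 else M, ?_, ?_⟩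
    · intro v _
      dsimp only
      split_ifs <;> linarith
    · rw [Finset.sum_insert hwτ, hp, add_comm (∑ v ∈ τ, M • v) w]
      simp only [if_true, one_smul]
      congr 1
      refine Finset.sum_congr rfl fun v hv => ?_
      rw [if_neg (fun h : v = w => hwτ (h ▸ hv))]
  have hp2 : InCone (insert w' τ) p := by
    refine ⟨fun v => if v = w' then c else M + a v, ?_, ?_⟩
    · intro v hv
      dsimp only
      split_ifs with h
      · exact hcpos.le
      · exact hMa v ((Finset.mem_insert.1 hv).resolve_left h)
    · rw [Finset.sum_insert hwτ', hp]
      have : w = ∑ v ∈ τ, a v • v + c • w' := by rw [ha]; abel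
      rw [this, ← add_assoc, ← Finset.sum_add_distrib, add_comm _ (c • w')]
      simp only [if_true]
      congr 1
      refine Finset.sum_congr rfl fun v hv => ?_
      rw [if_neg (fun h : v = w' => hwτ' (h ▸ hv)), add_smul]
  have hlp : l p = l w := by
    rw [hp, map_add, map_sum, Finset.sum_eq_zero, zero_add]
    intro v hv
    simp [hl v hv]
  have hpsum : 0 < ∑ i, p i := by
    have h1 : ∑ i, p i = (∑ v ∈ τ, M) + 1 := by
      rw [← (vertex_mem S hws (Finset.mem_insert_self w τ)).2,
        ← sum_coord τ (fun v hv => (vertex_mem S hτ hv).2), ← Finset.sum_add_distrib]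
      rfl
    rw [h1]
    have : 0 ≤ ∑ v ∈ τ, M := Finset.sum_nonneg fun v _ => hMpos.le
    linarith
  obtain ⟨b, -, hb⟩ := cone_inter S hws hws' hp1 hp2 hpsum
  apply hlw
  rw [← hlp, ← hb, map_sum]
  refine Finset.sum_eq_zero fun v hv => ?_
  have : v ∈ τ := by
    rw [Finset.mem_inter, Finset.mem_insert, Finset.mem_insert] at hv
    rcases hv with ⟨h1 | h1, h2 | h2⟩
    · exact absurd (h1.symm.trans h2) hne
    all_goals assumption
  simp [hl v this]

open Filter Topology in
lemma side_exists (S : SimplicialSubdivision d) {τ : Finset (Fin (d + 1) → ℝ)} {k : ℕ}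
    (hτ : τ ∈ S.simplices) (hV : ∀ v ∈ τ, v ∈ coordSub d k)
    (l : (Fin (d + 1) → ℝ) →ₗ[ℝ] ℝ) (hl : ∀ v ∈ τ, l v = 0)
    {u : Fin (d + 1) → ℝ} (hu : u ∈ coordSub d k) (hlu : 0 < l u)
    (hpos : ∀ i, (∃ v ∈ τ, 0 < v i) ∨ 0 ≤ u i) :
    ∃ w ∈ coordSub d k, w ∉ τ ∧ insert w τ ∈ S.simplices ∧ 0 < l w := by
  set b : Fin (d + 1) → ℝ := ∑ v ∈ τ, v with hb
  have hb0 : ∀ i, 0 ≤ b i := by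
    intro i
    rw [hb, Finset.sum_apply]
    exact Finset.sum_nonneg fun v hv => (vertex_mem S hτ hv).1 i
  have hlb : l b = 0 := by
    rw [hb, map_sum]
    exact Finset.sum_eq_zero hl
  have hbsum : 0 < ∑ i, b i := by
    have h1 : ∑ i, b i = ∑ v ∈ τ, (1 : ℝ) := by
      rw [← sum_coord τ (fun v hv => (vertex_mem S hτ hv).2)]
      simp [hb]
    rw [h1]
    simpa using S.nonempty_mem τ hτ
  let p : ℝ → Fin (d + 1) → ℝ := fun ε => b + ε • u
  have hpc : Continuous p := by fun_prop
  have hsc : Continuous fun ε => ∑ i, p ε i := by fun_prop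
  have hp0 : p 0 = b := by simp [p]
  let q : ℝ → Fin (d + 1) → ℝ := fun ε => (∑ i, p ε i)⁻¹ • p ε
  have hev0 : ∀ᶠ ε in 𝓝[>] (0 : ℝ), 0 < ε := eventually_mem_nhdsWithin
  have hevs : ∀ᶠ ε in 𝓝[>] (0 : ℝ), 0 < ∑ i, p ε i := by
    apply eventually_nhdsWithin_of_eventually_nhds
    apply hsc.continuousAt.eventually_const_lt
    simp only [hp0]
    exact hbsum
  have hevp : ∀ᶠ ε in 𝓝[>] (0 : ℝ), ∀ i, 0 ≤ p ε i := by
    rw [eventually_all]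
    intro i
    rcases hpos i with ⟨v, hv, hvi⟩ | hi
    · have hbi : 0 < b i := by
        rw [hb, Finset.sum_apply]
        exact Finset.sum_pos' (fun v hv => (vertex_mem S hτ hv).1 i) ⟨v, hv, hvi⟩
      have hc : Continuous fun ε => p ε i := by fun_prop
      apply eventually_nhdsWithin_of_eventually_nhds
      have : ∀ᶠ ε in 𝓝 (0 : ℝ), 0 < p ε i := by
        apply hc.continuousAt.eventually_const_lt
        simp only [hp0]
        exact hbi
      exact this.mono fun ε h => h.le
    · filter_upwards [hev0] with ε hε
      exact add_nonneg (hb0 i) (mul_nonneg hε.le hi)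
  have hqsum : ∀ ε, 0 < ∑ i, p ε i → ∑ i, q ε i = 1 := by
    intro ε h
    simp only [q, Pi.smul_apply, smul_eq_mul]
    rw [← Finset.mul_sum, inv_mul_cancel₀ h.ne']
  have hcov : ∀ᶠ ε in 𝓝[>] (0 : ℝ), ∃ ρ ∈ S.simplices,
      q ε ∈ convexHull ℝ (ρ : Set (Fin (d + 1) → ℝ)) := by
    filter_upwards [hevs, hevp] with ε h1 h2
    have : q ε ∈ stdSimplex ℝ (Fin (d + 1)) :=
      ⟨fun i => mul_nonneg (inv_pos.2 h1).le (h2 i), hqsum ε h1⟩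
    rw [← S.covers] at this
    simpa only [Set.mem_iUnion, exists_prop] using this
  obtain ⟨ρ, hρ, hfr⟩ : ∃ ρ ∈ S.simplices, ∃ᶠ ε in 𝓝[>] (0 : ℝ),
      q ε ∈ convexHull ℝ (ρ : Set (Fin (d + 1) → ℝ)) := by
    by_contra! h
    have h1 := (eventually_all_finset S.simplices).2 h
    obtain ⟨ε, h2, ρ, hρ, h3⟩ := (h1.and hcov).exists
    exact h2 ρ hρ h3
  have hρ1 : ∀ v ∈ ρ, ∑ i, v i = 1 := fun v hv => (vertex_mem S hρ hv).2
  have hq0 : q 0 ∈ convexHull ℝ (ρ : Set (Fin (d + 1) → ℝ)) := by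
    refine (Set.Finite.isClosed_convexHull ℝ ρ.finite_toSet).mem_of_frequently_of_tendsto hfr ?_
    have : ContinuousAt q 0 := by
      refine ContinuousAt.smul (ContinuousAt.inv₀ hsc.continuousAt ?_) hpc.continuousAt
      rw [hp0]
      exact hbsum.ne'
    exact this.tendsto.mono_left nhdsWithin_le_nhds
  have hunq : ∀ ε, 0 < ∑ i, p ε i → q ε ∈ convexHull ℝ (ρ : Set (Fin (d + 1) → ℝ)) →
      InCone ρ (p ε) := by
    intro ε h1 h2
    have h3 := ((mem_hull_iff hρ1).1 h2).1.smul h1.le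
    rwa [smul_inv_smul₀ h1.ne'] at h3
  have hbρ : InCone ρ b := by
    have := hunq 0 (by rw [hp0]; exact hbsum) hq0
    rwa [hp0] at this
  have hbτ : InCone τ b := ⟨fun _ => 1, fun _ _ => zero_le_one, by simp [hb]⟩
  have hsub : τ ⊆ ρ := by
    obtain ⟨a, -, ha⟩ := cone_inter S hρ hτ hbρ hbτ hbsum
    have h1 : ∑ v ∈ τ, (1 - if v ∈ ρ then a v else 0) • v = 0 := by
      simp only [sub_smul, one_smul, Finset.sum_sub_distrib, ite_smul, zero_smul]
      rw [← Finset.sum_filter, Finset.filter_mem_eq_inter, Finset.inter_comm τ ρ, ha, hb, sub_self]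
    intro v hv
    have h2 := lin_indep S hτ _ h1 v hv
    by_contra h3
    simp [h3] at h2
  obtain ⟨ε, hε1, hε0, hεs⟩ := (hfr.and_eventually (hev0.and hevs)).exists
  obtain ⟨a, ha0, ha⟩ := hunq ε hεs hε1
  have hlp : 0 < ∑ v ∈ ρ, a v * l v := by
    have : l (p ε) = ∑ v ∈ ρ, a v * l v := by
      rw [← ha, map_sum]
      simp
    rw [← this]
    simp only [p, map_add, map_smul, hlb, smul_eq_mul, zero_add]
    exact mul_pos hε0 hlu
  obtain ⟨w, hw, hwpos⟩ := Finset.exists_lt_of_sum_lt (s := ρ) (f := fun _ => (0 : ℝ))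
    (g := fun v => a v * l v) (by simpa using hlp)
  have haw : 0 < a w := by
    rcases (ha0 w hw).lt_or_eq with h | h
    · exact h
    · simp [← h] at hwpos
  have hlw : 0 < l w := pos_of_mul_pos_right hwpos haw.le
  refine ⟨w, ?_, fun h => hlw.ne' (hl w h), ?_, hlw⟩
  · intro i hi
    have h0 : p ε i = 0 := by
      have h1 : b i = 0 := (Submodule.sum_mem (coordSub d k) hV) i hi
      simp [p, h1, hu i hi]
    rw [← ha, Finset.sum_apply] at h0
    have h2 := (Finset.sum_eq_zero_iff_of_nonneg (fun v hv =>
      mul_nonneg (ha0 v hv) ((vertex_mem S hρ hv).1 i))).1 h0 w hw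
    exact (mul_eq_zero.1 h2).resolve_left haw.ne'
  · exact S.down_closed ρ hρ _ (Finset.insert_subset hw hsub) (Finset.insert_nonempty _ _)

lemma comb {α : Type*} [DecidableEq α] (σ : Finset α) (f : α → ℕ) (k : ℕ)
    (hc : σ.card = k + 1) (hf : ∀ v ∈ σ, f v < k + 1) :
    Odd (σ.filter (fun v => (σ.erase v).image f = Finset.range k)).card ↔
      σ.image f = Finset.range (k + 1) := by
  constructor
  · intro hodd
    by_contra hne
    obtain ⟨v₀, hv₀⟩ : (σ.filter (fun v => (σ.erase v).image f = Finset.range k)).Nonempty := by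
      rw [← Finset.card_pos]
      exact hodd.pos
    obtain ⟨hv₀σ, him⟩ := Finset.mem_filter.1 hv₀
    have himσ : σ.image f = insert (f v₀) (Finset.range k) := by
      rw [← him, ← Finset.image_insert, Finset.insert_erase hv₀σ]
    have hlt : f v₀ < k := by
      rcases (Nat.lt_succ_iff.1 (hf v₀ hv₀σ)).lt_or_eq with h | h
      · exact h
      · exact absurd (by rw [himσ, h, Finset.range_add_one]) hne
    have hinj : Set.InjOn f (σ.erase v₀ : Finset α) := by
      rw [← Finset.card_image_iff, him, Finset.card_erase_of_mem hv₀σ, hc]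
      simp
    obtain ⟨v₁, hv₁, hfv⟩ : ∃ v₁ ∈ σ.erase v₀, f v₁ = f v₀ := by
      rw [← Finset.mem_image, him]
      simpa using hlt
    obtain ⟨hv₁ne, hv₁σ⟩ := Finset.mem_erase.1 hv₁
    have hset : σ.filter (fun v => (σ.erase v).image f = Finset.range k) = {v₀, v₁} := by
      ext v
      simp only [Finset.mem_filter, Finset.mem_insert, Finset.mem_singleton]
      constructor
      · rintro ⟨hv, hvim⟩
        by_contra! hcon
        have h1 : f v ∈ (σ.erase v₀).image f :=
          Finset.mem_image_of_mem f (Finset.mem_erase.2 ⟨hcon.1, hv⟩)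
        rw [him, ← hvim] at h1
        obtain ⟨x, hx, hxv⟩ := Finset.mem_image.1 h1
        obtain ⟨hxne, hxσ⟩ := Finset.mem_erase.1 hx
        have hvm : v ∈ σ.erase v₀ := Finset.mem_erase.2 ⟨hcon.1, hv⟩
        by_cases hx0 : x = v₀
        · subst hx0
          exact hcon.2 (hinj hvm hv₁ (hxv.symm.trans hfv.symm))
        · exact hxne (hinj (Finset.mem_coe.2 (Finset.mem_erase.2 ⟨hx0, hxσ⟩)) hvm hxv)
      · rintro (rfl | rfl)
        · exact ⟨hv₀σ, him⟩
        · refine ⟨hv₁σ, ?_⟩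
          rw [← him]
          ext y
          simp only [Finset.mem_image, Finset.mem_erase]
          constructor
          · rintro ⟨x, ⟨h1, h2⟩, rfl⟩
            by_cases hx : x = v₀
            · exact ⟨v, ⟨hv₁ne, hv₁σ⟩, by rw [hx, hfv]⟩
            · exact ⟨x, ⟨hx, h2⟩, rfl⟩
          · rintro ⟨x, ⟨h1, h2⟩, rfl⟩
            by_cases hx : x = v
            · exact ⟨v₀, ⟨hv₁ne.symm, hv₀σ⟩, by rw [hx, hfv]⟩
            · exact ⟨x, ⟨hx, h2⟩, rfl⟩
    rw [hset, Finset.card_pair hv₁ne.symm] at hodd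
    exact absurd hodd (by decide)
  · intro him
    have hinj : Set.InjOn f (σ : Finset α) := by
      rw [← Finset.card_image_iff, him, hc]
      simp
    obtain ⟨v₀, hv₀, hfv⟩ : ∃ v₀ ∈ σ, f v₀ = k := by
      rw [← Finset.mem_image, him]
      simp
    have hset : σ.filter (fun v => (σ.erase v).image f = Finset.range k) = {v₀} := by
      ext v
      simp only [Finset.mem_filter, Finset.mem_singleton]
      constructor
      · rintro ⟨hv, hvim⟩
        by_contra hne
        have : k ∈ (σ.erase v).image f :=
          Finset.mem_image.2 ⟨v₀, Finset.mem_erase.2 ⟨fun h => hne h.symm, hv₀⟩, hfv⟩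
        rw [hvim] at this
        simp at this
      · rintro rfl
        refine ⟨hv₀, ?_⟩
        ext y
        simp only [Finset.mem_image, Finset.mem_erase, Finset.mem_range]
        constructor
        · rintro ⟨x, ⟨h1, h2⟩, rfl⟩
          have h3 : f x ≠ k := fun h => h1 (hinj h2 hv₀ (h.trans hfv.symm))
          have := hf x h2
          omega
        · intro hy
          have : y ∈ σ.image f := by
            rw [him]
            simp
            omega
          obtain ⟨x, hx, rfl⟩ := Finset.mem_image.1 this
          exact ⟨x, ⟨fun h => by subst h; omega, hx⟩, rfl⟩
    rw [hset]
    simp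

lemma functional_ne_zero (S : SimplicialSubdivision d) {τ : Finset (Fin (d + 1) → ℝ)}
    (hτ : τ ∈ S.simplices) (hcard : τ.card + 1 ≤ d + 1)
    (hV : ∀ v ∈ τ, v ∈ coordSub d (τ.card + 1))
    (l : (Fin (d + 1) → ℝ) →ₗ[ℝ] ℝ) (hl : ∀ v ∈ τ, l v = 0)
    {u : Fin (d + 1) → ℝ} (hu : u ∈ coordSub d (τ.card + 1)) (hlu : l u ≠ 0)
    {w : Fin (d + 1) → ℝ} (hw : w ∈ coordSub d (τ.card + 1)) (hwτ : w ∉ τ)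
    (hws : insert w τ ∈ S.simplices) : l w ≠ 0 := by
  intro h0
  obtain ⟨a, ha⟩ := ker_span S hτ hcard hV l hl hu hlu hw h0
  have h1 : ∑ v ∈ insert w τ, (if v = w then (-1 : ℝ) else a v) • v = 0 := by
    rw [Finset.sum_insert hwτ]
    have : ∑ v ∈ τ, (if v = w then (-1 : ℝ) else a v) • v = w := by
      rw [← ha]
      refine Finset.sum_congr rfl fun v hv => ?_
      rw [ha, if_neg (fun h : v = w => hwτ (h ▸ hv))]
    rw [this]
    simp
  have h2 := lin_indep S hws _ h1 w (Finset.mem_insert_self _ _)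
  simp at h2

/-- The simplices of the `k`-th coordinate face having one more vertex than `τ` and containing it. -/
lemma fiber_parity (S : SimplicialSubdivision d) (lab : (Fin (d + 1) → ℝ) → Fin (d + 1))
    (hlab : ∀ σ ∈ S.simplices, ∀ v ∈ σ, 0 < v (lab v)) {k : ℕ} (hk : k + 1 ≤ d + 1)
    {τ : Finset (Fin (d + 1) → ℝ)} (hτ : τ ∈ S.simplices)
    (hV : ∀ v ∈ τ, v ∈ coordSub d (k + 1)) (hcard : τ.card = k)
    (him : τ.image (fun v => (lab v).val) = Finset.range k) :
    Odd (S.simplices.filter (fun σ => ((∀ v ∈ σ, v ∈ coordSub d (k + 1)) ∧ σ.card = k + 1) ∧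
      τ ⊆ σ)).card ↔ ∀ v ∈ τ, v ∈ coordSub d k := by
  subst hcard
  have hmem : ∀ σ, σ ∈ S.simplices.filter
      (fun σ => ((∀ v ∈ σ, v ∈ coordSub d (τ.card + 1)) ∧ σ.card = τ.card + 1) ∧ τ ⊆ σ) ↔
      ∃ w, w ∈ coordSub d (τ.card + 1) ∧ w ∉ τ ∧ insert w τ ∈ S.simplices ∧ σ = insert w τ := by
    intro σ
    rw [Finset.mem_filter]
    constructor
    · rintro ⟨hσ, ⟨h1, h2⟩, h3⟩
      have h4 : (σ \ τ).card = 1 := by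
        rw [Finset.card_sdiff_of_subset h3]
        omega
      obtain ⟨w, hw⟩ := Finset.card_eq_one.1 h4
      have hw' : w ∈ σ \ τ := by rw [hw]; exact Finset.mem_singleton_self w
      rw [Finset.mem_sdiff] at hw'
      have hσ' : σ = insert w τ := by
        rw [Finset.insert_eq, ← hw, Finset.sdiff_union_of_subset h3]
      exact ⟨w, h1 w hw'.1, hw'.2, hσ' ▸ hσ, hσ'⟩
    · rintro ⟨w, hw, hwτ, hws, rfl⟩
      refine ⟨hws, ⟨?_, Finset.card_insert_of_notMem hwτ⟩, Finset.subset_insert _ _⟩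
      intro v hv
      rcases Finset.mem_insert.1 hv with rfl | h
      · exact hw
      · exact hV v h
  constructor
  · intro hodd
    by_contra hbd
    push Not at hbd
    obtain ⟨v₀, hv₀, hv₀V⟩ := hbd
    have hpos : ∀ i : Fin (d + 1), i.val < τ.card + 1 → ∃ v ∈ τ, 0 < v i := by
      intro i hi
      rcases (Nat.lt_succ_iff.1 hi).lt_or_eq with h | h
      · have : i.val ∈ τ.image (fun v => (lab v).val) := by
          rw [him]
          simpa using h
        obtain ⟨v, hv, hvi⟩ := Finset.mem_image.1 this
        have := hlab τ hτ v hv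
        rw [Fin.ext hvi] at this
        exact ⟨v, hv, this⟩
      · refine ⟨v₀, hv₀, ((vertex_mem S hτ hv₀).1 i).lt_of_ne fun h0 => hv₀V ?_⟩
        intro j hj
        rcases hj.lt_or_eq with h' | h'
        · exact hV v₀ hv₀ j h'
        · have : j = i := Fin.ext (by omega)
          rw [this, ← h0]
    obtain ⟨l, hl, u, hu, hlu⟩ := exists_functional (τ := τ) hk
    have key : ∀ (l' : (Fin (d + 1) → ℝ) →ₗ[ℝ] ℝ), (∀ v ∈ τ, l' v = 0) → l' u ≠ 0 →
        ∃ w ∈ coordSub d (τ.card + 1), w ∉ τ ∧ insert w τ ∈ S.simplices ∧ 0 < l' w := by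
      intro l' hl' hlu'
      refine side_exists S hτ hV l' hl' (u := l' u • u) (Submodule.smul_mem _ _ hu) ?_ ?_
      · rw [map_smul, smul_eq_mul]
        exact mul_self_pos.2 hlu'
      · intro i
        by_cases hi : i.val < τ.card + 1
        · exact Or.inl (hpos i hi)
        · right
          simp [hu i (by omega)]
    obtain ⟨w, hw, hwτ, hws, hlw⟩ := key l hl hlu
    obtain ⟨w', hw', hwτ', hws', hlw'⟩ := key (-l) (by simpa using hl) (by simpa using hlu)
    rw [LinearMap.neg_apply] at hlw'
    have hne : insert w τ ≠ insert w' τ := by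
      intro h
      have h1 : w ∈ insert w' τ := h ▸ Finset.mem_insert_self w τ
      rcases Finset.mem_insert.1 h1 with h2 | h2
      · rw [h2] at hlw
        linarith
      · exact hwτ h2
    have hset : S.simplices.filter
        (fun σ => ((∀ v ∈ σ, v ∈ coordSub d (τ.card + 1)) ∧ σ.card = τ.card + 1) ∧ τ ⊆ σ) =
        {insert w τ, insert w' τ} := by
      ext σ
      rw [hmem, Finset.mem_insert, Finset.mem_singleton]
      constructor
      · rintro ⟨x, hx, hxτ, hxs, rfl⟩
        have hx0 := functional_ne_zero S hτ hk hV l hl hu hlu hx hxτ hxs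
        rcases hx0.lt_or_gt with h | h
        · right
          rw [side_unique S hτ hk hV l hl hx hw' hxs hws' (mul_pos_of_neg_of_neg h (by linarith))]
        · left
          rw [side_unique S hτ hk hV l hl hx hw hxs hws (mul_pos h hlw)]
      · rintro (rfl | rfl)
        · exact ⟨w, hw, hwτ, hws, rfl⟩
        · exact ⟨w', hw', hwτ', hws', rfl⟩
    rw [hset, Finset.card_pair hne] at hodd
    exact absurd hodd (by decide)
  · intro hbd
    let κ : Fin (d + 1) := ⟨τ.card, by omega⟩
    let l : (Fin (d + 1) → ℝ) →ₗ[ℝ] ℝ := LinearMap.proj κ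
    have hl : ∀ v ∈ τ, l v = 0 := fun v hv => hbd v hv κ le_rfl
    let u : Fin (d + 1) → ℝ := Pi.single κ 1
    have hlu : l u = 1 := by simp [l, u]
    have hu : u ∈ coordSub d (τ.card + 1) := by
      intro i hi
      have : i ≠ κ := by
        rintro rfl
        simp [κ] at hi
      simp [u, this]
    obtain ⟨w, hw, hwτ, hws, hlw⟩ := side_exists S hτ hV l hl hu (by rw [hlu]; exact one_pos)
      (fun i => Or.inr (by
        by_cases h : i = κ
        · subst h; simp [u]
        · simp [u, h]))
    have hset : S.simplices.filter
        (fun σ => ((∀ v ∈ σ, v ∈ coordSub d (τ.card + 1)) ∧ σ.card = τ.card + 1) ∧ τ ⊆ σ) =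
        {insert w τ} := by
      ext σ
      rw [hmem, Finset.mem_singleton]
      constructor
      · rintro ⟨x, hx, hxτ, hxs, rfl⟩
        have hx0 := functional_ne_zero S hτ hk hV l hl hu (by rw [hlu]; exact one_ne_zero) hx hxτ hxs
        have hx1 : 0 ≤ l x := (vertex_mem S hxs (Finset.mem_insert_self _ _)).1 κ
        rw [side_unique S hτ hk hV l hl hx hw hxs hws (mul_pos (hx1.lt_of_ne hx0.symm) hlw)]
      · rintro rfl
        exact ⟨w, hw, hwτ, hws, rfl⟩
    rw [hset]
    simp

/-- The fully labeled simplices of the `k`-th coordinate face. -/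
noncomputable def full (S : SimplicialSubdivision d) (lab : (Fin (d + 1) → ℝ) → Fin (d + 1))
    (k : ℕ) : Finset (Finset (Fin (d + 1) → ℝ)) :=
  S.simplices.filter (fun σ => (∀ v ∈ σ, v ∈ coordSub d k) ∧ σ.card = k ∧
    σ.image (fun v => (lab v).val) = Finset.range k)

lemma lab_lt (S : SimplicialSubdivision d) (lab : (Fin (d + 1) → ℝ) → Fin (d + 1))
    (hlab : ∀ σ ∈ S.simplices, ∀ v ∈ σ, 0 < v (lab v)) {k : ℕ}
    {σ : Finset (Fin (d + 1) → ℝ)} (hσ : σ ∈ S.simplices) {v : Fin (d + 1) → ℝ} (hv : v ∈ σ)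
    (hvk : v ∈ coordSub d k) : (lab v).val < k := by
  by_contra h
  have h1 := hlab σ hσ v hv
  rw [hvk _ (by omega)] at h1
  exact lt_irrefl _ h1

lemma step (S : SimplicialSubdivision d) (lab : (Fin (d + 1) → ℝ) → Fin (d + 1))
    (hlab : ∀ σ ∈ S.simplices, ∀ v ∈ σ, 0 < v (lab v)) {k : ℕ} (hk0 : 1 ≤ k)
    (hk : k + 1 ≤ d + 1) : Odd (full S lab (k + 1)).card ↔ Odd (full S lab k).card := by
  set A := S.simplices.filter (fun σ => (∀ v ∈ σ, v ∈ coordSub d (k + 1)) ∧ σ.card = k + 1) with hA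
  set B := S.simplices.filter (fun τ => (∀ v ∈ τ, v ∈ coordSub d (k + 1)) ∧ τ.card = k ∧
    τ.image (fun v => (lab v).val) = Finset.range k) with hB
  have hdc := Finset.sum_card_bipartiteAbove_eq_sum_card_bipartiteBelow
    (fun σ τ : Finset (Fin (d + 1) → ℝ) => τ ⊆ σ) (s := A) (t := B)
  have hodd := congrArg Odd hdc
  rw [Finset.odd_sum_iff_odd_card_odd, Finset.odd_sum_iff_odd_card_odd] at hodd
  have e1 : A.filter (fun σ => Odd (Finset.bipartiteAbove
      (fun σ τ : Finset (Fin (d + 1) → ℝ) => τ ⊆ σ) B σ).card) = full S lab (k + 1) := by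
    rw [full]
    ext σ
    simp only [hA, Finset.mem_filter, and_assoc]
    refine and_congr_right fun hσ => and_congr_right fun hσV => and_congr_right fun hσc => ?_
    rw [← comb σ (fun v => (lab v).val) k hσc
      (fun v hv => lab_lt S lab hlab hσ hv (hσV v hv))]
    have : Finset.bipartiteAbove (fun σ τ : Finset (Fin (d + 1) → ℝ) => τ ⊆ σ) B σ =
        (σ.filter (fun v => (σ.erase v).image (fun v => (lab v).val) = Finset.range k)).image
          (fun v => σ.erase v) := by
      ext τ
      simp only [Finset.mem_bipartiteAbove, hB, Finset.mem_filter, Finset.mem_image]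
      constructor
      · rintro ⟨⟨hτ, h1, h2, h3⟩, h4⟩
        have h5 : (σ \ τ).card = 1 := by
          rw [Finset.card_sdiff_of_subset h4]
          omega
        obtain ⟨w, hw⟩ := Finset.card_eq_one.1 h5
        have hw' : w ∈ σ \ τ := by rw [hw]; exact Finset.mem_singleton_self w
        have h6 : σ.erase w = τ := by
          rw [Finset.erase_eq, ← hw, Finset.sdiff_sdiff_eq_self h4]
        exact ⟨w, ⟨(Finset.mem_sdiff.1 hw').1, by rw [h6]; exact h3⟩, h6⟩
      · rintro ⟨w, ⟨hw, h1⟩, rfl⟩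
        have hc : (σ.erase w).card = k := by
          rw [Finset.card_erase_of_mem hw]
          omega
        refine ⟨⟨S.down_closed σ hσ _ (Finset.erase_subset _ _) ?_, ?_, hc, h1⟩,
          Finset.erase_subset _ _⟩
        · rw [← Finset.card_pos]
          omega
        · exact fun v hv => hσV v (Finset.mem_of_mem_erase hv)
    rw [this, Finset.card_image_of_injOn]
    exact (Finset.erase_injOn σ).mono (fun v hv => (Finset.mem_filter.1 hv).1)
  have e2 : B.filter (fun τ => Odd (Finset.bipartiteBelow
      (fun σ τ : Finset (Fin (d + 1) → ℝ) => τ ⊆ σ) A τ).card) = full S lab k := by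
    rw [full]
    ext τ
    have hAB : Finset.bipartiteBelow (fun σ τ : Finset (Fin (d + 1) → ℝ) => τ ⊆ σ) A τ =
        S.simplices.filter (fun σ => ((∀ v ∈ σ, v ∈ coordSub d (k + 1)) ∧ σ.card = k + 1) ∧
          τ ⊆ σ) := by
      rw [Finset.bipartiteBelow, hA, Finset.filter_filter]
    simp only [hB, Finset.mem_filter]
    rw [hAB]
    constructor
    · rintro ⟨⟨hτ, h1, h2, h3⟩, h4⟩
      exact ⟨hτ, (fiber_parity S lab hlab hk hτ h1 h2 h3).1 h4, h2, h3⟩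
    · rintro ⟨hτ, h1, h2, h3⟩
      have h1' : ∀ v ∈ τ, v ∈ coordSub d (k + 1) := fun v hv i hi => h1 v hv i (by omega)
      exact ⟨⟨hτ, h1', h2, h3⟩, (fiber_parity S lab hlab hk hτ h1' h2 h3).2 h1⟩
  rw [e1, e2] at hodd
  exact Iff.of_eq hodd

lemma base (S : SimplicialSubdivision d) (lab : (Fin (d + 1) → ℝ) → Fin (d + 1))
    (hlab : ∀ σ ∈ S.simplices, ∀ v ∈ σ, 0 < v (lab v)) : Odd (full S lab 1).card := by
  have huniq : ∀ v : Fin (d + 1) → ℝ, v ∈ coordSub d 1 → ∑ i, v i = 1 → v = Pi.single 0 1 := by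
    intro v hv hs
    have hz : ∀ i : Fin (d + 1), i ≠ 0 → v i = 0 := fun i hi =>
      hv i (Nat.one_le_iff_ne_zero.2 fun h => hi (Fin.ext h))
    rw [Finset.sum_eq_single 0 (fun i _ hi => hz i hi) (by simp)] at hs
    funext i
    by_cases hi : i = 0
    · subst hi
      simp [hs]
    · simp [hz i hi, hi]
  have h0 : (Pi.single 0 1 : Fin (d + 1) → ℝ) ∈ stdSimplex ℝ (Fin (d + 1)) :=
    single_mem_stdSimplex ℝ 0
  rw [← S.covers] at h0
  simp only [Set.mem_iUnion, exists_prop] at h0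
  obtain ⟨ρ, hρ, hx⟩ := h0
  obtain ⟨a, ha0, ha1, ha⟩ := Finset.mem_convexHull'.1 hx
  obtain ⟨w, hw, hwpos⟩ := Finset.exists_lt_of_sum_lt (s := ρ) (f := fun _ => (0 : ℝ))
    (g := a) (by rw [ha1]; simp)
  have hwV : w ∈ coordSub d 1 := by
    intro i hi
    have hi0 : i ≠ 0 := by
      rintro rfl
      simp at hi
    have h1 := congrFun ha i
    rw [Finset.sum_apply, Pi.single_eq_of_ne hi0] at h1
    have h2 := (Finset.sum_eq_zero_iff_of_nonneg (fun v hv =>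
      mul_nonneg (ha0 v hv) ((vertex_mem S hρ hv).1 i))).1 h1 w hw
    exact (mul_eq_zero.1 h2).resolve_left hwpos.ne'
  have hws : {w} ∈ S.simplices :=
    S.down_closed ρ hρ _ (Finset.singleton_subset_iff.2 hw) (Finset.singleton_nonempty _)
  have hset : full S lab 1 = {{w}} := by
    rw [full]
    ext σ
    rw [Finset.mem_filter, Finset.mem_singleton]
    constructor
    · rintro ⟨hσ, h1, h2, -⟩
      obtain ⟨v, rfl⟩ := Finset.card_eq_one.1 h2
      have hv := Finset.mem_singleton_self v
      rw [huniq v (h1 v hv) (vertex_mem S hσ hv).2, huniq w hwV (vertex_mem S hρ hw).2]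
    · rintro rfl
      have := lab_lt S lab hlab hρ hw hwV
      refine ⟨hws, ?_, Finset.card_singleton _, ?_⟩
      · intro v hv
        rw [Finset.mem_singleton.1 hv]
        exact hwV
      · rw [Finset.image_singleton, Nat.lt_one_iff.1 this]
        rfl
  rw [hset]
  simp

end SpernerAux

/-- Sperner's lemma, strong form: for any Sperner labeling of a simplicial
subdivision of `Δ^d` (every vertex lying in a face `conv{e_i : i ∈ I}` of `Δ^d` is
labeled by an element of `I`), the number of fully-labeled `d`-simplices is odd. -/
theorem sperner_strong (d : ℕ) (S : SimplicialSubdivision d)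
    (lab : (Fin (d + 1) → ℝ) → Fin (d + 1))
    (hSperner : ∀ σ ∈ S.simplices, ∀ v ∈ σ, ∀ I : Finset (Fin (d + 1)),
      v ∈ convexHull ℝ ((fun i : Fin (d + 1) => (Pi.single i 1 : Fin (d + 1) → ℝ)) ''
          (I : Set (Fin (d + 1)))) → lab v ∈ I) :
    Odd ((S.simplices.filter
      (fun σ => σ.card = d + 1 ∧ σ.image lab = Finset.univ)).card) := by
  have hlab : ∀ σ ∈ S.simplices, ∀ v ∈ σ, 0 < v (lab v) := by
    intro σ hσ v hv
    have hvm := SpernerAux.vertex_mem S hσ hv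
    have h1 := hSperner σ hσ v hv (Finset.univ.filter fun i => v i ≠ 0) ?_
    · exact (hvm.1 _).lt_of_ne (Finset.mem_filter.1 h1).2.symm
    · have h2 : v = ∑ i ∈ Finset.univ.filter (fun i => v i ≠ 0),
          v i • (Pi.single i 1 : Fin (d + 1) → ℝ) := by
        rw [Finset.sum_filter_of_ne]
        · funext j
          simp [Finset.sum_apply, Pi.single_apply]
        · intro i _ hi h0
          exact hi (by rw [h0, zero_smul])
      rw [h2]
      refine (convex_convexHull ℝ _).sum_mem (fun i _ => hvm.1 i) ?_ ?_
      · rw [Finset.sum_filter_ne_zero]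
        exact hvm.2
      · intro i hi
        refine subset_convexHull ℝ _ ⟨i, ?_, rfl⟩
        rw [← h2]
        exact hi
  have hall : ∀ k, 1 ≤ k → k ≤ d + 1 → Odd (SpernerAux.full S lab k).card := by
    intro k hk
    induction k, hk using Nat.le_induction with
    | base => exact fun _ => SpernerAux.base S lab hlab
    | succ k hk ih => exact fun h => (SpernerAux.step S lab hlab hk h).2 (ih (by omega))
  have hfin := hall (d + 1) (by omega) le_rfl
  convert hfin using 2
  rw [SpernerAux.full]
  ext σ
  rw [Finset.mem_filter, Finset.mem_filter]
  refine and_congr_right fun hσ => ?_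
  constructor
  · rintro ⟨h1, h2⟩
    refine ⟨fun v _ i hi => absurd i.2 (by omega), h1, ?_⟩
    ext y
    rw [Finset.mem_image, Finset.mem_range]
    constructor
    · rintro ⟨v, _, rfl⟩
      exact (lab v).2
    · intro hy
      have : (⟨y, hy⟩ : Fin (d + 1)) ∈ σ.image lab := by
        rw [h2]
        exact Finset.mem_univ _
      obtain ⟨v, hv, hvy⟩ := Finset.mem_image.1 this
      exact ⟨v, hv, by rw [hvy]⟩
  · rintro ⟨_, h1, h2⟩
    refine ⟨h1, Finset.eq_univ_iff_forall.2 fun y => ?_⟩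
    have : y.val ∈ σ.image (fun v => (lab v).val) := by
      rw [h2, Finset.mem_range]
      exact y.2
    obtain ⟨v, hv, hvy⟩ := Finset.mem_image.1 this
    exact Finset.mem_image.2 ⟨v, hv, Fin.ext hvy⟩
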